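/- Let $Q\subset\mathbb{R}^n$ be a cube and let $g\in L^q(Q)$ with $q>1$, $f\in L^s(Q)$ with $s>q$, both nonnegative. Suppose there are constants $b>1$, $R_0>0$, $0\le\theta<1$ such that for every $x_0\in Q$ and every $R<\min\{\frac12\mathrm{dist}(x_0,\partial Q),R_0\}$, $\fint_{Q_R(x_0)}g^q\le b\big(\fint_{Q_{2R}(x_0)}g\big)^q+\fint_{Q_{2R}(x_0)}f^q+\theta\fint_{Q_{2R}(x_0)}g^q$. Then there exist $\epsilon>0$ and $c>0$ depending only on $b,\theta,q,n,s$ such that $g\in L^p_{loc}(Q)$ for $p\in[q,q+\epsilon)$ and, for all cubes $Q_{2R}\subset Q$ with $R<R_0$, $\big(\fint_{Q_R}g^p\big)^{1/p}\le c\big(\big(\fint_{Q_{2R}}g^q\big)^{1/q}+\big(\fint_{Q_{2R}}f^p\big)^{1/p}\big)$. -/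

import Mathlib

open MeasureTheory
open scoped ENNReal

/-- The axis-parallel cube with center `c` and side length `l`. -/
def cube {n : ℕ} (c : EuclideanSpace ℝ (Fin n)) (l : ℝ) : Set (EuclideanSpace ℝ (Fin n)) :=
  {x | ∀ i, |x i - c i| ≤ l / 2}

section Helpers

open Set

lemma lc {α : Type*} [MeasurableSpace α] (ν : Measure α) (h : α → ℝ≥0∞) (hm : Measurable h)
    (N a : ℝ) (hN : 0 ≤ N) (ha : 0 < a) :
    ∫⁻ x, (min (h x) (ENNReal.ofReal N)) ^ a ∂ν
      = ENNReal.ofReal a * ∫⁻ t in Ioo 0 N, ν {x | ENNReal.ofReal t < h x} *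
          ENNReal.ofReal (t ^ (a - 1)) := by
  have hfin : ∀ x, min (h x) (ENNReal.ofReal N) ≠ ⊤ := fun x =>
    ne_top_of_le_ne_top ENNReal.ofReal_ne_top (min_le_right _ _)
  have hmeas : Measurable (fun x => (min (h x) (ENNReal.ofReal N)).toReal) :=
    (hm.min measurable_const).ennreal_toReal
  have key := lintegral_rpow_eq_lintegral_meas_lt_mul ν
    (f := fun x => (min (h x) (ENNReal.ofReal N)).toReal)
    (Filter.Eventually.of_forall fun x => ENNReal.toReal_nonneg) hmeas.aemeasurable ha
  have e1 : ∀ x, ENNReal.ofReal ((min (h x) (ENNReal.ofReal N)).toReal ^ a)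
      = (min (h x) (ENNReal.ofReal N)) ^ a := fun x => by
    rw [← ENNReal.ofReal_rpow_of_nonneg ENNReal.toReal_nonneg ha.le, ENNReal.ofReal_toReal (hfin x)]
  simp_rw [e1] at key
  rw [key]
  congr 1
  have e2 : Ioo (0:ℝ) N = Iio N ∩ Ioi 0 := by ext; simp [and_comm]
  rw [e2, ← Measure.restrict_restrict measurableSet_Iio, ← lintegral_indicator measurableSet_Iio]
  refine setLIntegral_congr_fun measurableSet_Ioi fun t ht => ?_
  have ht' : 0 < t := ht
  have e3 : ∀ x, (t < (min (h x) (ENNReal.ofReal N)).toReal) ↔ (ENNReal.ofReal t < h x ∧ t < N) := by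
    intro x
    rw [← ENNReal.ofReal_lt_iff_lt_toReal ht'.le (hfin x), lt_min_iff,
      ENNReal.ofReal_lt_ofReal_iff_of_nonneg ht'.le]
  by_cases htN : t < N
  · simp [e3, htN]
  · simp [e3, htN]

lemma absorb {X a : ℝ≥0∞} (hX : X ≠ ⊤) (h : X ≤ a + 2⁻¹ * X) : X ≤ 2 * a := by
  by_cases ha : a = ⊤
  · simp [ha]
  lift X to NNReal using hX
  lift a to NNReal using ha
  have h2 : (2⁻¹ : ℝ≥0∞) = ((2⁻¹ : NNReal) : ℝ≥0∞) := by simp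
  rw [h2] at h
  norm_cast at h ⊢
  rw [← NNReal.coe_le_coe] at h ⊢
  push_cast at h ⊢
  linarith

lemma selfimp_trunc {α : Type*} [MeasurableSpace α] (μ : Measure α) (u v : α → ℝ≥0∞)
    (hu : Measurable u) (hv : Measurable v) (q p K H l0 N : ℝ) (hq : 1 < q) (hp : q < p)
    (hK : 0 ≤ K) (hH : 1 ≤ H) (hN : 0 ≤ N)
    (hfin : ∫⁻ x, u x ^ q ∂μ < ⊤)
    (hyp : ∀ t : ℝ, 0 < t → l0 ≤ t → ∫⁻ x in {x | ENNReal.ofReal t < u x}, u x ^ q ∂μ ≤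
      ENNReal.ofReal K * (ENNReal.ofReal (t ^ (q - 1)) *
        ∫⁻ x in {x | ENNReal.ofReal t < ENNReal.ofReal H * u x}, u x ∂μ
        + ∫⁻ x in {x | ENNReal.ofReal t < ENNReal.ofReal H * v x}, v x ^ q ∂μ))
    (hsmall : (p - q) * K * H ^ (p - 1) / (p - 1) ≤ 1 / 2) :
    ∫⁻ x, u x ^ q * (min (u x) (ENNReal.ofReal N)) ^ (p - q) ∂μ ≤
      2 * (ENNReal.ofReal l0 ^ (p - q) * ∫⁻ x, u x ^ q ∂μ +
        ENNReal.ofReal K * ENNReal.ofReal H ^ (p - q) * ∫⁻ x, v x ^ p ∂μ) := by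
  set NN := ENNReal.ofReal N with hNN
  set HH := ENNReal.ofReal H with hHH
  set KK := ENNReal.ofReal K with hKK
  have hHH1 : 1 ≤ HH := by rw [hHH]; simpa using hH
  have mu_q : Measurable fun x => u x ^ q := hu.pow_const _
  have mv_q : Measurable fun x => v x ^ q := hv.pow_const _
  have hpq : 0 < p - q := by linarith
  have hp1 : 0 < p - 1 := by linarith
  set X := ∫⁻ x, u x ^ q * (min (u x) NN) ^ (p - q) ∂μ with hX
  have hXfin : X ≠ ⊤ := by
    have : X ≤ ∫⁻ x, u x ^ q * NN ^ (p - q) ∂μ := by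
      refine lintegral_mono fun x => ?_
      gcongr
      exact min_le_right _ _
    refine ne_top_of_le_ne_top ?_ this
    rw [lintegral_mul_const _ mu_q]
    exact ENNReal.mul_ne_top hfin.ne (ENNReal.rpow_ne_top_of_nonneg hpq.le ENNReal.ofReal_ne_top)
  -- layer cakes
  have wd : ∀ (r a : ℝ) (ρ h : α → ℝ≥0∞), Measurable ρ → Measurable h → 0 < a →
      ENNReal.ofReal a * ∫⁻ t in Ioo 0 N, (∫⁻ x in {x | ENNReal.ofReal t < h x}, ρ x ∂μ) *
          ENNReal.ofReal (t ^ (a - 1)) = ∫⁻ x, ρ x * (min (h x) NN) ^ a ∂μ := by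
    intro r a ρ h hρ hh ha
    have := lc (μ.withDensity ρ) h hh N a hN ha
    rw [lintegral_withDensity_eq_lintegral_mul _ hρ ((hh.min measurable_const).pow_const _)] at this
    simp only [Pi.mul_apply] at this
    rw [this]
    congr 1
    refine lintegral_congr fun t => ?_
    rw [withDensity_apply _ (measurableSet_lt measurable_const hh)]
  have L0 := wd 0 (p - q) (fun x => u x ^ q) u mu_q hu hpq
  have L1 := wd 0 (p - q) (fun x => u x ^ q) (fun _ => ENNReal.ofReal l0) mu_q measurable_const hpq
  have L2 := wd 0 (p - 1) u (fun x => HH * u x) hu (hu.const_mul _) hp1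
  have L3 := wd 0 (p - q) (fun x => v x ^ q) (fun x => HH * v x) mv_q (hv.const_mul _) hpq
  -- measurability in t
  have mt : ∀ (ρ h : α → ℝ≥0∞), Measurable fun t : ℝ => ∫⁻ x in {x | ENNReal.ofReal t < h x}, ρ x ∂μ := by
    intro ρ h
    have : Antitone fun t : ℝ => ∫⁻ x in {x | ENNReal.ofReal t < h x}, ρ x ∂μ := by
      intro s t hst
      refine lintegral_mono_set fun x hx => ?_
      exact lt_of_le_of_lt (ENNReal.ofReal_le_ofReal hst) hx
    exact this.measurable
  have mp : ∀ a : ℝ, Measurable fun t : ℝ => ENNReal.ofReal (t ^ a) := fun a => by fun_prop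
  have mtp : ∀ (ρ h : α → ℝ≥0∞) (a : ℝ), Measurable fun t : ℝ =>
      (∫⁻ x in {x | ENNReal.ofReal t < h x}, ρ x ∂μ) * ENNReal.ofReal (t ^ a) :=
    fun ρ h a => (mt ρ h).mul (mp a)
  have main : X ≤ (∫⁻ x, u x ^ q * (min (ENNReal.ofReal l0) NN) ^ (p - q) ∂μ)
      + KK * (ENNReal.ofReal ((p - q) / (p - 1)) * ∫⁻ x, u x * (min (HH * u x) NN) ^ (p - 1) ∂μ)
      + KK * ∫⁻ x, v x ^ q * (min (HH * v x) NN) ^ (p - q) ∂μ := by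
    rw [hX, ← L0, ← L1, ← L2, ← L3]
    have e : ENNReal.ofReal ((p - q) / (p - 1)) * (ENNReal.ofReal (p - 1) *
        ∫⁻ t in Ioo 0 N, (∫⁻ x in {x | ENNReal.ofReal t < HH * u x}, u x ∂μ) *
          ENNReal.ofReal (t ^ (p - 1 - 1))) = ENNReal.ofReal (p - q) * 
        ∫⁻ t in Ioo 0 N, (∫⁻ x in {x | ENNReal.ofReal t < HH * u x}, u x ∂μ) *
          ENNReal.ofReal (t ^ (p - 1 - 1)) := by
      rw [← mul_assoc, ← ENNReal.ofReal_mul (by positivity), div_mul_cancel₀ _ hp1.ne']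
    rw [e, mul_left_comm KK, mul_left_comm KK, ← mul_add, ← mul_add]
    gcongr
    rw [← lintegral_const_mul _ (mtp _ _ _), ← lintegral_const_mul _ (mtp _ _ _),
      ← lintegral_add_left (mtp _ _ _), ← lintegral_add_left]
    swap
    · exact (mtp _ _ _).add ((mtp _ _ _).const_mul _)
    refine setLIntegral_mono' measurableSet_Ioo fun t ht => ?_
    have ht0 : 0 < t := ht.1
    by_cases htl : l0 ≤ t
    · have := hyp t ht0 htl
      have e2 : ENNReal.ofReal (t ^ (p - 1 - 1)) = ENNReal.ofReal (t ^ (q - 1)) *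
          ENNReal.ofReal (t ^ (p - q - 1)) := by
        rw [← ENNReal.ofReal_mul (by positivity), ← Real.rpow_add ht0]
        ring_nf
      calc _ ≤ _ := mul_le_mul_left this _
        _ = KK * ((∫⁻ x in {x | ENNReal.ofReal t < HH * u x}, u x ∂μ) *
          ENNReal.ofReal (t ^ (p - 1 - 1))) + KK * ((∫⁻ x in {x | ENNReal.ofReal t < HH * v x}, v x ^ q ∂μ) *
          ENNReal.ofReal (t ^ (p - q - 1))) := by rw [e2]; ring
        _ ≤ _ := by
          gcongr
          exact le_add_self
    · push Not at htl
      have : {x : α | ENNReal.ofReal t < ENNReal.ofReal l0} = univ := by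
        ext x
        simp only [mem_ofPred_eq, mem_univ, iff_true]
        exact (ENNReal.ofReal_lt_ofReal_iff_of_nonneg ht0.le).2 htl
      rw [this]
      rw [add_assoc]
      refine le_trans ?_ le_self_add
      gcongr
      exact subset_univ _
  have hminH : ∀ y : ℝ≥0∞, min (HH * y) NN ≤ HH * min y NN := by
    intro y
    rcases le_total y NN with h | h
    · rw [min_eq_left h]; exact min_le_left _ _
    · rw [min_eq_right h]
      exact (min_le_right _ _).trans (le_mul_of_one_le_left zero_le hHH1)
  apply absorb hXfin
  refine main.trans ?_
  have B1 : (∫⁻ x, u x ^ q * (min (ENNReal.ofReal l0) NN) ^ (p - q) ∂μ) ≤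
      ENNReal.ofReal l0 ^ (p - q) * ∫⁻ x, u x ^ q ∂μ := by
    rw [lintegral_mul_const _ mu_q, mul_comm]
    gcongr
    exact min_le_left _ _
  have B3 : ∫⁻ x, v x ^ q * (min (HH * v x) NN) ^ (p - q) ∂μ ≤ HH ^ (p - q) * ∫⁻ x, v x ^ p ∂μ := by
    rw [← lintegral_const_mul _ (hv.pow_const _)]
    refine lintegral_mono fun x => ?_
    calc v x ^ q * (min (HH * v x) NN) ^ (p - q) ≤ v x ^ q * (HH * v x) ^ (p - q) := by
          gcongr; exact min_le_left _ _
      _ = HH ^ (p - q) * (v x ^ q * v x ^ (p - q)) := by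
          rw [ENNReal.mul_rpow_of_nonneg _ _ hpq.le]; ring
      _ = _ := by
          rw [← ENNReal.rpow_add_of_nonneg _ _ (by linarith) hpq.le]; simp
  have B2 : ∫⁻ x, u x * (min (HH * u x) NN) ^ (p - 1) ∂μ ≤ HH ^ (p - 1) * X := by
    have mm : Measurable fun x => u x ^ q * (min (u x) NN) ^ (p - q) :=
      mu_q.mul ((hu.min measurable_const).pow_const _)
    rw [hX, ← lintegral_const_mul _ mm]
    refine lintegral_mono fun x => ?_
    calc u x * (min (HH * u x) NN) ^ (p - 1) ≤ u x * (HH * min (u x) NN) ^ (p - 1) := by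
          gcongr; exact hminH _
      _ = HH ^ (p - 1) * (u x * (min (u x) NN ^ (q - 1) * min (u x) NN ^ (p - q))) := by
          rw [ENNReal.mul_rpow_of_nonneg _ _ hp1.le,
            ← ENNReal.rpow_add_of_nonneg _ _ (by linarith) hpq.le]; ring_nf
      _ ≤ HH ^ (p - 1) * (u x * (u x ^ (q - 1) * min (u x) NN ^ (p - q))) := by
          have hq1 : 0 ≤ q - 1 := by linarith
          have := ENNReal.rpow_le_rpow (min_le_left (u x) NN) hq1
          gcongr HH ^ (p - 1) * (u x * (?_ * min (u x) NN ^ (p - q)))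
      _ = HH ^ (p - 1) * ((u x ^ (1:ℝ) * u x ^ (q - 1)) * min (u x) NN ^ (p - q)) := by
          rw [ENNReal.rpow_one]; ring
      _ = _ := by
          rw [← ENNReal.rpow_add_of_nonneg _ _ (by linarith) (by linarith)]; simp
  have B2' : KK * (ENNReal.ofReal ((p - q) / (p - 1)) * ∫⁻ x, u x * (min (HH * u x) NN) ^ (p - 1) ∂μ)
      ≤ 2⁻¹ * X := by
    calc _ ≤ KK * (ENNReal.ofReal ((p - q) / (p - 1)) * (HH ^ (p - 1) * X)) := by gcongr
      _ = ENNReal.ofReal ((p - q) * K * H ^ (p - 1) / (p - 1)) * X := by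
        rw [hKK, hHH, ENNReal.ofReal_rpow_of_nonneg (by linarith) hp1.le, ← mul_assoc, ← mul_assoc,
          ← ENNReal.ofReal_mul hK, ← ENNReal.ofReal_mul (by positivity)]
        congr 2; ring
      _ ≤ ENNReal.ofReal (1 / 2) * X := by gcongr
      _ = _ := by
        congr 1
        rw [one_div, ENNReal.ofReal_inv_of_pos (by norm_num)]; simp
  calc _ ≤ ENNReal.ofReal l0 ^ (p - q) * ∫⁻ x, u x ^ q ∂μ + 2⁻¹ * X + KK * (HH ^ (p - q) * ∫⁻ x, v x ^ p ∂μ) := by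
        gcongr
    _ = _ := by ring

lemma selfimp {α : Type*} [MeasurableSpace α] (μ : Measure α) (u v : α → ℝ≥0∞)
    (hu : Measurable u) (hv : Measurable v) (q p K H l0 : ℝ) (hq : 1 < q) (hp : q < p)
    (hK : 0 ≤ K) (hH : 1 ≤ H)
    (hfin : ∫⁻ x, u x ^ q ∂μ < ⊤)
    (hyp : ∀ t : ℝ, 0 < t → l0 ≤ t → ∫⁻ x in {x | ENNReal.ofReal t < u x}, u x ^ q ∂μ ≤
      ENNReal.ofReal K * (ENNReal.ofReal (t ^ (q - 1)) *
        ∫⁻ x in {x | ENNReal.ofReal t < ENNReal.ofReal H * u x}, u x ∂μ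
        + ∫⁻ x in {x | ENNReal.ofReal t < ENNReal.ofReal H * v x}, v x ^ q ∂μ))
    (hsmall : (p - q) * K * H ^ (p - 1) / (p - 1) ≤ 1 / 2) :
    ∫⁻ x, u x ^ p ∂μ ≤
      2 * (ENNReal.ofReal l0 ^ (p - q) * ∫⁻ x, u x ^ q ∂μ +
        ENNReal.ofReal K * ENNReal.ofReal H ^ (p - q) * ∫⁻ x, v x ^ p ∂μ) := by
  have hpq : 0 < p - q := by linarith
  have T := lintegral_tendsto_of_tendsto_of_monotone (μ := μ)
    (f := fun (N : ℕ) x => u x ^ q * (min (u x) (ENNReal.ofReal N)) ^ (p - q))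
    (F := fun x => u x ^ p) ?_ ?_ ?_
  · refine le_of_tendsto' T fun N => ?_
    exact selfimp_trunc μ u v hu hv q p K H l0 N hq hp hK hH (by positivity) hfin hyp hsmall
  · intro N
    exact ((hu.pow_const _).mul ((hu.min measurable_const).pow_const _)).aemeasurable
  · refine Filter.Eventually.of_forall fun x a b hab => ?_
    simp only
    gcongr
  · refine Filter.Eventually.of_forall fun x => ?_
    have e : u x ^ p = u x ^ q * u x ^ (p - q) := by
      rw [← ENNReal.rpow_add_of_nonneg _ _ (by linarith) hpq.le]; simp
    by_cases h0 : u x = 0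
    · simp [h0, show 0 < q by linarith, show 0 < p by linarith]
    rw [e]
    refine ENNReal.Tendsto.const_mul ?_ (Or.inl ?_)
    · refine (ENNReal.continuous_rpow_const.tendsto _).comp ?_
      have h1 : Filter.Tendsto (fun N : ℕ => ENNReal.ofReal (N : ℝ)) Filter.atTop (nhds ⊤) := by
        simpa using ENNReal.tendsto_nat_nhds_top
      simpa using (tendsto_const_nhds (x := u x)).min h1
    · simp [h0, hp.le]

lemma tail_est {α : Type*} [MeasurableSpace α] (μ : Measure α) (S : Set α)
    (h : α → ℝ≥0∞) (hh : Measurable h) (c : ℝ≥0∞) (hc : c ≠ ⊤) (hS : μ S ≠ ⊤)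
    (hle : c * μ S ≤ ∫⁻ x in S, h x ∂μ) :
    c / 2 * μ S ≤ ∫⁻ x in S ∩ {x | c / 2 < h x}, h x ∂μ := by
  have hm : MeasurableSet {x | c / 2 < h x} := measurableSet_lt measurable_const hh
  have h1 := lintegral_inter_add_sdiff (μ := μ) h S hm
  have h2 : ∫⁻ x in S \ {x | c / 2 < h x}, h x ∂μ ≤ c / 2 * μ S := by
    calc _ ≤ ∫⁻ x in S \ {x | c / 2 < h x}, c / 2 ∂μ := by
          have hr : ∀ᵐ x ∂(μ.restrict (S \ {x | c / 2 < h x})), h x ≤ c / 2 := by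
            have : S \ {x | c / 2 < h x} ⊆ {x | h x ≤ c / 2} := by
              intro x hx; simpa using hx.2
            have h3 : MeasurableSet {x | h x ≤ c / 2} := measurableSet_le hh measurable_const
            exact ae_restrict_of_ae_restrict_of_subset this (ae_restrict_mem h3)
          exact lintegral_mono_ae hr
      _ = c / 2 * μ (S \ {x | c / 2 < h x}) := by simp
      _ ≤ _ := by gcongr; exact sdiff_subset
  have hfin : c / 2 * μ S ≠ ⊤ := ENNReal.mul_ne_top (ENNReal.div_ne_top hc (by simp)) hS
  have h3 : c / 2 * μ S + c / 2 * μ S ≤ (∫⁻ x in S ∩ {x | c / 2 < h x}, h x ∂μ) + c / 2 * μ S := by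
    calc _ = c * μ S := by rw [← add_mul, ENNReal.add_halves]
      _ ≤ _ := hle
      _ ≤ _ := by rw [← h1]; gcongr
  exact (ENNReal.add_le_add_iff_right hfin).1 h3

lemma local_est {α : Type*} [MeasurableSpace α] (μ : Measure α) (S L : Set α)
    (hSm : MeasurableSet S) (hLm : MeasurableSet L)
    (g f W : α → ℝ≥0∞) (hg : Measurable g) (hf : Measurable f) (hW : Measurable W)
    (q : ℝ) (hq : 1 < q) (W0 M t κ D c1 c2 K H : ℝ≥0∞)
    (hS0 : μ S ≠ 0) (hS : μ S ≠ ⊤)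
    (hW00 : W0 ≠ 0) (hW0 : W0 ≠ ⊤) (hWt : ∀ y ∈ S, W y ≠ ⊤)
    (hM0 : M ≠ 0) (hM : M ≠ ⊤) (htM : M * W0 = t)
    (hκ : κ ≠ ⊤)
    (hWL : ∀ y ∈ L, W y ≤ κ * W0) (hWS : ∀ y ∈ S, W0 ≤ κ * W y)
    (hL : ∫⁻ x in L, g x ^ q ∂μ ≤ D * μ S * M ^ q)
    (hc10 : c1 ≠ 0) (hc1 : c1 ≠ ⊤) (hc20 : c2 ≠ 0) (hc2 : c2 ≠ ⊤)
    (hH1 : 2 * κ ≤ H * c1) (hH2 : 2 * κ ^ q ≤ H ^ q * c2)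
    (hK1 : D * κ ^ q * (2 * κ) ≤ K * c1) (hK2 : D * κ ^ q * (2 * κ ^ q) ≤ K * c2)
    (hdich : c1 * M ≤ (μ S)⁻¹ * ∫⁻ x in S, g x ∂μ ∨ c2 * M ^ q ≤ (μ S)⁻¹ * ∫⁻ x in S, f x ^ q ∂μ) :
    ∫⁻ x in L, (g x * W x) ^ q ∂μ ≤ K * (t ^ (q - 1) *
        ∫⁻ x in S ∩ {x | t < H * (g x * W x)}, g x * W x ∂μ
        + ∫⁻ x in S ∩ {x | t < H * (f x * W x)}, (f x * W x) ^ q ∂μ) := by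
  have hq0 : 0 < q := by linarith
  have ht0 : t ≠ 0 := by rw [← htM]; exact mul_ne_zero hM0 hW00
  have htt : t ≠ ⊤ := by rw [← htM]; exact ENNReal.mul_ne_top hM hW0
  have hWy0 : ∀ y ∈ S, W y ≠ 0 := by
    intro y hy h
    have := hWS y hy
    rw [h, mul_zero] at this
    exact hW00 (le_antisymm this zero_le)
  have hqt : t ^ q = t ^ (q - 1) * t := by
    nth_rewrite 3 [← ENNReal.rpow_one t]
    rw [← ENNReal.rpow_add _ _ ht0 htt]; simp
  have hLu : ∫⁻ x in L, (g x * W x) ^ q ∂μ ≤ D * κ ^ q * (t ^ q * μ S) := by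
    calc _ ≤ ∫⁻ x in L, (κ * W0) ^ q * g x ^ q ∂μ := by
          refine setLIntegral_mono' hLm fun x hx => ?_
          rw [mul_comm (g x), ENNReal.mul_rpow_of_nonneg _ _ hq0.le]
          gcongr
          exact hWL x hx
      _ = (κ * W0) ^ q * ∫⁻ x in L, g x ^ q ∂μ := lintegral_const_mul _ (hg.pow_const _)
      _ ≤ (κ * W0) ^ q * (D * μ S * M ^ q) := by gcongr
      _ = _ := by
        rw [← htM, ENNReal.mul_rpow_of_nonneg _ _ hq0.le, ENNReal.mul_rpow_of_nonneg _ _ hq0.le]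
        ring
  rcases hdich with h | h
  · have h1 : c1 * M * μ S ≤ ∫⁻ x in S, g x ∂μ := by
      rw [mul_comm (μ S)⁻¹, ← div_eq_mul_inv] at h
      rwa [ENNReal.le_div_iff_mul_le (Or.inl hS0) (Or.inl hS)] at h
    have h2 := tail_est μ S g hg (c1 * M) (ENNReal.mul_ne_top hc1 hM) hS h1
    set T := S ∩ {x | c1 * M / 2 < g x} with hT
    have hTm : MeasurableSet T := hSm.inter (measurableSet_lt measurable_const hg)
    have hsub : T ⊆ S ∩ {x | t < H * (g x * W x)} := by
      rintro y ⟨hy, hy2⟩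
      refine ⟨hy, ?_⟩
      have hH0 : H ≠ 0 := by
        rintro rfl
        have hk : κ ≠ 0 := by
          rintro rfl
          have := hWS y hy
          simp at this
          exact hW00 this
        simp [hk] at hH1
      change t < H * (g y * W y)
      have hy3 : c1 * M / 2 < g y := hy2
      by_cases hHt : H = ⊤
      · rw [hHt, ENNReal.top_mul]
        · exact htt.lt_top
        · exact mul_ne_zero (ne_of_gt (lt_of_le_of_lt zero_le hy3)) (hWy0 y hy)
      calc t = M * W0 := htM.symm
        _ ≤ M * (κ * W y) := by gcongr; exact hWS y hy
        _ = (2 * κ) * (M / 2 * W y) := by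
          rw [ENNReal.div_eq_inv_mul]
          have : (2:ℝ≥0∞) * 2⁻¹ = 1 := ENNReal.mul_inv_cancel (by simp) (by simp)
          calc _ = 1 * (M * (κ * W y)) := by ring
            _ = _ := by rw [← this]; ring
        _ ≤ (H * c1) * (M / 2 * W y) := by gcongr
        _ = H * (c1 * M / 2 * W y) := by simp only [div_eq_mul_inv]; ring
        _ < H * (g y * W y) :=
          ENNReal.mul_lt_mul_right hH0 hHt (ENNReal.mul_lt_mul_left (hWy0 y hy) (hWt y hy) hy3)
    have h3 : W0 * ∫⁻ x in T, g x ∂μ ≤ κ * ∫⁻ x in T, g x * W x ∂μ := by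
      rw [← lintegral_const_mul _ hg, ← lintegral_const_mul _ (show Measurable fun x => g x * W x from hg.mul hW)]
      refine setLIntegral_mono' hTm fun x hx => ?_
      calc W0 * g x ≤ κ * W x * g x := by gcongr; exact hWS x hx.1
        _ = _ := by ring
    refine le_trans ?_ (mul_le_mul_right (le_self_add) K)
    rw [← ENNReal.mul_le_mul_iff_right hc10 hc1]
    calc c1 * ∫⁻ x in L, (g x * W x) ^ q ∂μ ≤ c1 * (D * κ ^ q * (t ^ q * μ S)) := by gcongr
      _ = D * κ ^ q * 2 * t ^ (q - 1) * (W0 * (c1 * M / 2 * μ S)) := by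
        have : (2:ℝ≥0∞) * 2⁻¹ = 1 := ENNReal.mul_inv_cancel (by simp) (by simp)
        rw [hqt, div_eq_mul_inv]
        nth_rewrite 2 [← htM]
        calc _ = c1 * (D * κ ^ q * (t ^ (q - 1) * (M * W0) * μ S)) * 1 := by ring
          _ = _ := by rw [← this]; ring
      _ ≤ D * κ ^ q * 2 * t ^ (q - 1) * (κ * ∫⁻ x in T, g x * W x ∂μ) := by
        gcongr D * κ ^ q * 2 * t ^ (q - 1) * ?_
        exact le_trans (by gcongr) h3
      _ = (D * κ ^ q * (2 * κ)) * (t ^ (q - 1) * ∫⁻ x in T, g x * W x ∂μ) := by ring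
      _ ≤ (K * c1) * (t ^ (q - 1) * ∫⁻ x in S ∩ {x | t < H * (g x * W x)}, g x * W x ∂μ) := by
        gcongr
      _ = _ := by ring
  · have h1 : c2 * M ^ q * μ S ≤ ∫⁻ x in S, f x ^ q ∂μ := by
      rw [mul_comm (μ S)⁻¹, ← div_eq_mul_inv] at h
      rwa [ENNReal.le_div_iff_mul_le (Or.inl hS0) (Or.inl hS)] at h
    have h2 := tail_est μ S (fun x => f x ^ q) (hf.pow_const _) (c2 * M ^ q)
      (ENNReal.mul_ne_top hc2 (ENNReal.rpow_ne_top_of_nonneg hq0.le hM)) hS h1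
    set T := S ∩ {x | c2 * M ^ q / 2 < f x ^ q} with hT
    have hTm : MeasurableSet T := hSm.inter (measurableSet_lt measurable_const (hf.pow_const _))
    have hWSq : ∀ y ∈ S, W0 ^ q ≤ κ ^ q * W y ^ q := by
      intro y hy
      rw [← ENNReal.mul_rpow_of_nonneg _ _ hq0.le]
      exact ENNReal.rpow_le_rpow (hWS y hy) hq0.le
    have hsub : T ⊆ S ∩ {x | t < H * (f x * W x)} := by
      rintro y ⟨hy, hy2⟩
      refine ⟨hy, ?_⟩
      have hH0 : H ≠ 0 := by
        rintro rfl
        have hk : κ ≠ 0 := by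
          rintro rfl
          have := hWS y hy
          simp at this
          exact hW00 this
        simp [hk] at hH1
      change t < H * (f y * W y)
      have hy3 : c2 * M ^ q / 2 < f y ^ q := hy2
      by_cases hHt : H = ⊤
      · rw [hHt, ENNReal.top_mul]
        · exact htt.lt_top
        · refine mul_ne_zero ?_ (hWy0 y hy)
          intro h0
          rw [h0, ENNReal.zero_rpow_of_pos hq0] at hy3
          exact absurd hy3 (by simp)
      rw [← ENNReal.rpow_lt_rpow_iff hq0]
      calc t ^ q = M ^ q * W0 ^ q := by rw [← htM, ENNReal.mul_rpow_of_nonneg _ _ hq0.le]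
        _ ≤ M ^ q * (κ ^ q * W y ^ q) := by gcongr; exact hWSq y hy
        _ = (2 * κ ^ q) * (M ^ q / 2 * W y ^ q) := by
          rw [ENNReal.div_eq_inv_mul]
          have : (2:ℝ≥0∞) * 2⁻¹ = 1 := ENNReal.mul_inv_cancel (by simp) (by simp)
          calc _ = 1 * (M ^ q * (κ ^ q * W y ^ q)) := by ring
            _ = _ := by rw [← this]; ring
        _ ≤ (H ^ q * c2) * (M ^ q / 2 * W y ^ q) := by gcongr
        _ = H ^ q * (c2 * M ^ q / 2 * W y ^ q) := by simp only [div_eq_mul_inv]; ring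
        _ < H ^ q * (f y ^ q * W y ^ q) := by
          refine ENNReal.mul_lt_mul_right ?_ ?_ (ENNReal.mul_lt_mul_left ?_ ?_ hy3)
          · simp [hH0, hHt]
          · exact ENNReal.rpow_ne_top_of_nonneg hq0.le hHt
          · simp [hWy0 y hy, hWt y hy]
          · exact ENNReal.rpow_ne_top_of_nonneg hq0.le (hWt y hy)
        _ = (H * (f y * W y)) ^ q := by
          rw [ENNReal.mul_rpow_of_nonneg _ _ hq0.le, ENNReal.mul_rpow_of_nonneg _ _ hq0.le]
    have h3 : W0 ^ q * ∫⁻ x in T, f x ^ q ∂μ ≤ κ ^ q * ∫⁻ x in T, (f x * W x) ^ q ∂μ := by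
      rw [← lintegral_const_mul _ (hf.pow_const _), 
        ← lintegral_const_mul _ (show Measurable fun x => (f x * W x) ^ q from (hf.mul hW).pow_const _)]
      refine setLIntegral_mono' hTm fun x hx => ?_
      calc W0 ^ q * f x ^ q ≤ κ ^ q * W x ^ q * f x ^ q := by gcongr; exact hWSq x hx.1
        _ = _ := by rw [ENNReal.mul_rpow_of_nonneg _ _ hq0.le]; ring
    refine le_trans ?_ (mul_le_mul_right (le_add_self) K)
    rw [← ENNReal.mul_le_mul_iff_right hc20 hc2]
    calc c2 * ∫⁻ x in L, (g x * W x) ^ q ∂μ ≤ c2 * (D * κ ^ q * (t ^ q * μ S)) := by gcongr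
      _ = D * κ ^ q * 2 * (W0 ^ q * (c2 * M ^ q / 2 * μ S)) := by
        have : (2:ℝ≥0∞) * 2⁻¹ = 1 := ENNReal.mul_inv_cancel (by simp) (by simp)
        rw [div_eq_mul_inv, ← htM, ENNReal.mul_rpow_of_nonneg _ _ hq0.le]
        calc _ = c2 * (D * κ ^ q * (M ^ q * W0 ^ q * μ S)) * 1 := by ring
          _ = _ := by rw [← this]; ring
      _ ≤ D * κ ^ q * 2 * (κ ^ q * ∫⁻ x in T, (f x * W x) ^ q ∂μ) := by
        gcongr D * κ ^ q * 2 * ?_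
        exact le_trans (by gcongr) h3
      _ = (D * κ ^ q * (2 * κ ^ q)) * (∫⁻ x in T, (f x * W x) ^ q ∂μ) := by ring
      _ ≤ (K * c2) * (∫⁻ x in S ∩ {x | t < H * (f x * W x)}, (f x * W x) ^ q ∂μ) := by
        gcongr
      _ = _ := by ring

lemma first_jump (a : ℕ → ℝ≥0∞) (B : ℝ≥0∞) (h4 : ∀ j < 4, a j ≤ B) (h : ∃ k, B < a k) :
    ∃ k, B < a (k + 4) ∧ ∀ j < k + 4, a j ≤ B := by
  classical
  have h1 := Nat.find_spec h
  have h2 : ∀ j < Nat.find h, a j ≤ B := fun j hj => not_lt.1 (Nat.find_min h hj)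
  have h3 : 4 ≤ Nat.find h := by
    by_contra hlt
    exact absurd h1 (not_lt.2 (h4 _ (by omega)))
  obtain ⟨k, hk⟩ := Nat.exists_eq_add_of_le' h3
  rw [hk] at h1 h2
  exact ⟨k, h1, h2⟩

lemma sum_le {α ι : Type*} [MeasurableSpace α] (μ : Measure α) (U : Set ι) (hU : U.Countable)
    (S : ι → Set α) (hS : ∀ i, MeasurableSet (S i)) (hd : U.PairwiseDisjoint S) (Q P : Set α)
    (hP : MeasurableSet P) (hSQ : ∀ i ∈ U, S i ⊆ Q) (h : α → ℝ≥0∞) :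
    ∑' i : U, ∫⁻ x in S i ∩ P, h x ∂μ ≤ ∫⁻ x in P, h x ∂(μ.restrict Q) := by
  rw [Measure.restrict_restrict hP, ← lintegral_biUnion hU (fun i _ => (hS i).inter hP)
    (hd.mono fun i => inter_subset_left) h]
  refine lintegral_mono_set ?_
  intro x hx
  simp only [mem_iUnion] at hx
  obtain ⟨i, hi, hx⟩ := hx
  exact ⟨hx.2, hSQ i hi hx.1⟩

lemma dich (b θ q : ℝ) (hq : 1 < q) (hb : 1 < b) (hθ0 : 0 ≤ θ) (hθ1 : θ < 1)
    (X Y A M : ℝ≥0∞)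
    (h : M ^ q < ENNReal.ofReal b * X ^ q + Y + ENNReal.ofReal θ * A) (hA : A ≤ M ^ q) :
    ENNReal.ofReal (((1 - θ) / (2 * b)) ^ (1 / q)) * M ≤ X ∨
      ENNReal.ofReal ((1 - θ) / 2) * M ^ q ≤ Y := by
  have hq0 : 0 < q := by linarith
  have h1θ : 0 < 1 - θ := by linarith
  by_contra! hc
  obtain ⟨h1, h2⟩ := hc
  have h3 : X ^ q ≤ ENNReal.ofReal ((1 - θ) / (2 * b)) * M ^ q := by
    calc X ^ q ≤ (ENNReal.ofReal (((1 - θ) / (2 * b)) ^ (1 / q)) * M) ^ q :=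
          ENNReal.rpow_le_rpow h1.le hq0.le
      _ = _ := by
        rw [ENNReal.mul_rpow_of_nonneg _ _ hq0.le, ENNReal.ofReal_rpow_of_nonneg (by positivity) hq0.le,
          ← Real.rpow_mul (by positivity), one_div_mul_cancel hq0.ne', Real.rpow_one]
  refine absurd h (not_lt.2 ?_)
  calc _ ≤ ENNReal.ofReal b * (ENNReal.ofReal ((1 - θ) / (2 * b)) * M ^ q)
        + ENNReal.ofReal ((1 - θ) / 2) * M ^ q + ENNReal.ofReal θ * M ^ q := by
        gcongr
    _ = (ENNReal.ofReal b * ENNReal.ofReal ((1 - θ) / (2 * b)) + ENNReal.ofReal ((1 - θ) / 2)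
          + ENNReal.ofReal θ) * M ^ q := by ring
    _ = M ^ q := by
      rw [← ENNReal.ofReal_mul (by positivity), ← ENNReal.ofReal_add (by positivity) (by positivity),
        ← ENNReal.ofReal_add (by positivity) (by positivity)]
      have : b * ((1 - θ) / (2 * b)) + (1 - θ) / 2 + θ = 1 := by field_simp; ring
      rw [this]; simp

lemma vol_ball (n : ℕ) (x : Fin n → ℝ) (r : ℝ) (hr : 0 ≤ r) :
    volume (Metric.closedBall x r) = ENNReal.ofReal (2 * r) ^ n := by
  rw [Real.volume_pi_closedBall x hr, Fintype.card_fin, ENNReal.ofReal_pow (by positivity)]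

lemma level_est (n : ℕ) (q b θ K H : ℝ) (hq : 1 < q) (hb : 1 < b) (hθ0 : 0 ≤ θ) (hθ1 : θ < 1)
    (c1 c2 κ : ℝ≥0∞) (hc1 : c1 = ENNReal.ofReal (((1 - θ) / (2 * b)) ^ (1 / q)))
    (hc2 : c2 = ENNReal.ofReal ((1 - θ) / 2)) (hκ : κ = 2 ^ ((n : ℝ) / q))
    (hH1 : 2 * κ ≤ ENNReal.ofReal H * c1) (hH2 : 2 * κ ^ q ≤ ENNReal.ofReal H ^ q * c2)
    (hK1 : 8 ^ n * κ ^ q * (2 * κ) ≤ ENNReal.ofReal K * c1)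
    (hK2 : 8 ^ n * κ ^ q * (2 * κ ^ q) ≤ ENNReal.ofReal K * c2)
    (x0 : Fin n → ℝ) (R : ℝ) (hR : 0 < R) (g f : (Fin n → ℝ) → ℝ≥0∞)
    (hg : Measurable g) (hf : Measurable f)
    (hI : ∫⁻ x in Metric.closedBall x0 R, g x ^ q < ⊤)
    (hyp : ∀ x ∈ Metric.ball x0 R, ∀ r : ℝ, 0 < r → 4 * r ≤ R - dist x x0 →
      (volume (Metric.closedBall x r))⁻¹ * ∫⁻ y in Metric.closedBall x r, g y ^ q
        ≤ ENNReal.ofReal b * ((volume (Metric.closedBall x (2 * r)))⁻¹ *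
              ∫⁻ y in Metric.closedBall x (2 * r), g y) ^ q
          + (volume (Metric.closedBall x (2 * r)))⁻¹ * (∫⁻ y in Metric.closedBall x (2 * r), f y ^ q)
          + ENNReal.ofReal θ * ((volume (Metric.closedBall x (2 * r)))⁻¹ *
              ∫⁻ y in Metric.closedBall x (2 * r), g y ^ q))
    (W : (Fin n → ℝ) → ℝ≥0∞)
    (hW : W = fun y => ENNReal.ofReal ((R - dist y x0) / R) ^ ((n : ℝ) / q))
    (t : ℝ) (ht : 0 < t)
    (htI : ENNReal.ofReal (8 / R) ^ n * (∫⁻ x in Metric.closedBall x0 R, g x ^ q)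
      ≤ ENNReal.ofReal t ^ q) :
    ∫⁻ x in {x | ENNReal.ofReal t < g x * W x}, (g x * W x) ^ q ∂(volume.restrict (Metric.ball x0 R))
      ≤ ENNReal.ofReal K * (ENNReal.ofReal t ^ (q - 1) *
        ∫⁻ x in {x | ENNReal.ofReal t < ENNReal.ofReal H * (g x * W x)}, g x * W x
          ∂(volume.restrict (Metric.ball x0 R))
        + ∫⁻ x in {x | ENNReal.ofReal t < ENNReal.ofReal H * (f x * W x)}, (f x * W x) ^ q
          ∂(volume.restrict (Metric.ball x0 R))) := by
  have hq0 : 0 < q := by linarith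
  have hnq : 0 ≤ (n : ℝ) / q := by positivity
  have hWm : Measurable W := by rw [hW]; fun_prop
  have hWq : ∀ y, W y ^ q = ENNReal.ofReal ((R - dist y x0) / R) ^ n := by
    intro y
    rw [hW]
    simp only
    rw [← ENNReal.rpow_mul, div_mul_cancel₀ _ hq0.ne', ENNReal.rpow_natCast]
  have hWt : ∀ y, W y ≠ ⊤ := by
    intro y; rw [hW]; exact ENNReal.rpow_ne_top_of_nonneg hnq ENNReal.ofReal_ne_top
  have hW0 : ∀ y ∈ Metric.ball x0 R, W y ≠ 0 := by
    intro y hy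
    have hy' : dist y x0 < R := hy
    rw [hW]
    have : 0 < (R - dist y x0) / R := div_pos (by linarith) hR
    simp [this]
  set T := ENNReal.ofReal t with hT
  have hT0 : T ≠ 0 := by simpa [hT] using ht
  have hTt : T ≠ ⊤ := ENNReal.ofReal_ne_top
  -- comparability of the weights
  have hWcmp : ∀ x y : Fin n → ℝ, R - dist y x0 ≤ 2 * (R - dist x x0) → W y ≤ κ * W x := by
    intro x y h
    rw [hW, hκ]
    simp only
    rw [← ENNReal.mul_rpow_of_nonneg _ _ hnq]
    refine ENNReal.rpow_le_rpow ?_ hnq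
    have h2 : (2:ℝ≥0∞) = ENNReal.ofReal 2 := by simp
    rw [h2, ← ENNReal.ofReal_mul (by norm_num)]
    refine ENNReal.ofReal_le_ofReal ?_
    rw [← mul_div_assoc]
    gcongr
  set A : (Fin n → ℝ) → ℝ → ℝ≥0∞ := fun x r =>
    (volume (Metric.closedBall x r))⁻¹ * ∫⁻ y in Metric.closedBall x r, g y ^ q with hA
  -- Lebesgue differentiation
  have hleb : ∀ᵐ x : Fin n → ℝ, x ∈ Metric.ball x0 R → T < g x * W x →
      ∃ r : ℝ, 0 < r ∧ 32 * r ≤ R - dist x x0 ∧ (T / W x) ^ q < A x r ∧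
        A x (2 * r) ≤ (T / W x) ^ q ∧ A x (16 * r) ≤ (T / W x) ^ q := by
    have hmeas : Measurable ((Metric.closedBall x0 R).indicator fun x => g x ^ q) :=
      (hg.pow_const _).indicator Metric.isClosed_closedBall.measurableSet
    have := (IsUnifLocDoublingMeasure.vitaliFamily (volume : Measure (Fin n → ℝ)) 1).ae_tendsto_lintegral_div
      hmeas.aemeasurable (by rw [lintegral_indicator Metric.isClosed_closedBall.measurableSet]; exact hI.ne)
    filter_upwards [this] with x hx hxB hTx
    have hxB' : dist x x0 < R := hxB
    set d := R - dist x x0 with hd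
    have hd0 : 0 < d := by linarith
    have hWx0 := hW0 x hxB
    have hρ : ∀ k : ℕ, 0 < d / 2 / 2 ^ k := fun k => by positivity
    have hsub : ∀ k : ℕ, Metric.closedBall x (d / 2 / 2 ^ k) ⊆ Metric.closedBall x0 R := by
      intro k
      refine Metric.closedBall_subset_closedBall' ?_
      have : d / 2 / 2 ^ k ≤ d := by
        rw [div_div]
        refine div_le_self hd0.le ?_
        have : (1:ℝ) ≤ 2 ^ k := one_le_pow₀ (by norm_num)
        linarith
      linarith
    have hlim : Filter.Tendsto (fun k : ℕ => d / 2 / 2 ^ k) Filter.atTop (nhdsWithin 0 (Ioi 0)) := by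
      refine tendsto_nhdsWithin_iff.2 ⟨?_, Filter.Eventually.of_forall fun k => hρ k⟩
      have h1 := tendsto_pow_atTop_nhds_zero_of_lt_one (r := (1/2 : ℝ)) (by norm_num) (by norm_num)
      have h2 := h1.const_mul (d / 2)
      rw [mul_zero] at h2
      refine h2.congr fun k => ?_
      rw [one_div, inv_pow, div_eq_mul_inv (d / 2) (2 ^ k)]
    have hten := hx.comp (IsUnifLocDoublingMeasure.tendsto_closedBall_filterAt (K := 1) (x := x)
      (volume : Measure (Fin n → ℝ))
      (fun _ : ℕ => x) (fun k : ℕ => d / 2 / 2 ^ k) hlim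
      (Filter.Eventually.of_forall fun k => by
        rw [one_mul]; exact Metric.mem_closedBall_self (hρ k).le))
    have hten' : Filter.Tendsto (fun k : ℕ => A x (d / 2 / 2 ^ k)) Filter.atTop (nhds (g x ^ q)) := by
      have hxc : x ∈ Metric.closedBall x0 R := Metric.ball_subset_closedBall hxB
      rw [indicator_of_mem hxc] at hten
      refine hten.congr fun k => ?_
      simp only [Function.comp, hA]
      rw [div_eq_mul_inv, mul_comm]
      congr 1
      refine setLIntegral_congr_fun Metric.isClosed_closedBall.measurableSet fun y hy => ?_
      rw [indicator_of_mem (hsub k hy)]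
    have hTg : T / W x < g x := by
      rw [ENNReal.div_lt_iff (Or.inl hWx0) (Or.inl (hWt x))]
      exact hTx
    have hex : ∃ k : ℕ, (T / W x) ^ q < A x (d / 2 / 2 ^ k) := by
      by_contra! hcon
      have := le_of_tendsto' hten' hcon
      exact absurd (ENNReal.rpow_lt_rpow hTg hq0) (not_lt.2 this)
    have hfirst : ∀ j < 4, A x (d / 2 / 2 ^ j) ≤ (T / W x) ^ q := by
      intro j hj
      rw [ENNReal.div_rpow_of_nonneg _ _ hq0.le, ENNReal.le_div_iff_mul_le
        (Or.inl (by simp [hWx0, hWt x])) (Or.inl (ENNReal.rpow_ne_top_of_nonneg hq0.le (hWt x)))]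
      refine le_trans ?_ htI
      rw [hWq, ← hd]
      simp only [hA]
      rw [vol_ball n x _ (hρ j).le]
      have h8 : ((2:ℝ)) ^ j ≤ 8 := by
        calc (2:ℝ) ^ j ≤ 2 ^ 3 := pow_le_pow_right₀ (by norm_num) (by omega)
          _ = 8 := by norm_num
      have e1 : (ENNReal.ofReal (2 * (d / 2 / 2 ^ j)))⁻¹ = ENNReal.ofReal (2 ^ j / d) := by
        rw [← ENNReal.ofReal_inv_of_pos (by positivity)]
        congr 1; field_simp
      rw [ENNReal.inv_pow, e1]
      calc _ = (ENNReal.ofReal (2 ^ j / d) * ENNReal.ofReal (d / R)) ^ n *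
            ∫⁻ y in Metric.closedBall x (d / 2 / 2 ^ j), g y ^ q := by rw [mul_pow]; ring
        _ ≤ _ := by
          gcongr
          · rw [← ENNReal.ofReal_mul (by positivity)]
            refine ENNReal.ofReal_le_ofReal ?_
            rw [div_mul_div_cancel₀ hd0.ne']
            gcongr
          · exact hsub j
    obtain ⟨k, hk1, hk2⟩ := first_jump (fun k => A x (d / 2 / 2 ^ k)) _ hfirst hex
    refine ⟨d / 2 / 2 ^ (k + 4), hρ _, ?_, hk1, ?_, ?_⟩
    · have : (1:ℝ) ≤ 2 ^ k := one_le_pow₀ (by norm_num)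
      rw [pow_add, div_div, mul_div_assoc', div_le_iff₀ (by positivity)]
      nlinarith
    · have := hk2 (k + 3) (by omega)
      have e : 2 * (d / 2 / 2 ^ (k + 4)) = d / 2 / 2 ^ (k + 3) := by
        rw [pow_succ 2 (k + 3)]; field_simp
      rw [e]; exact this
    · have := hk2 k (by omega)
      have e : 16 * (d / 2 / 2 ^ (k + 4)) = d / 2 / 2 ^ k := by
        rw [pow_add]; field_simp; norm_num
      rw [e]; exact this
  -- choose the radii
  set G : Set (Fin n → ℝ) := {x | (x ∈ Metric.ball x0 R ∧ T < g x * W x) ∧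
      ∃ r : ℝ, 0 < r ∧ 32 * r ≤ R - dist x x0 ∧ (T / W x) ^ q < A x r ∧
        A x (2 * r) ≤ (T / W x) ^ q ∧ A x (16 * r) ≤ (T / W x) ^ q} with hG
  have hrad : ∀ x, ∃ r : ℝ, x ∈ G → 0 < r ∧ 32 * r ≤ R - dist x x0 ∧ (T / W x) ^ q < A x r ∧
        A x (2 * r) ≤ (T / W x) ^ q ∧ A x (16 * r) ≤ (T / W x) ^ q := by
    intro x
    by_cases hx : x ∈ G
    · obtain ⟨r, hr⟩ := hx.2
      exact ⟨r, fun _ => hr⟩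
    · exact ⟨0, fun h => absurd h hx⟩
  choose r hr using hrad
  obtain ⟨U, hUG, hUd, hUc⟩ := Vitali.exists_disjoint_subfamily_covering_enlargement_closedBall
    G (fun x => x) (fun x => 2 * r x) R (fun x hx => by
      have h1 := hr x hx
      have h2 : 0 ≤ dist x x0 := dist_nonneg
      linarith [h1.1, h1.2.1]) 5 (by norm_num)
  have hUcount : U.Countable := by
    refine hUd.countable_of_nonempty_interior fun x hx => ?_
    have h1 := hr x (hUG hx)
    refine ⟨x, Metric.ball_subset_interior_closedBall (Metric.mem_ball_self ?_)⟩
    linarith [h1.1]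
  have hballs : ∀ x ∈ U, Metric.closedBall x (2 * r x) ⊆ Metric.ball x0 R := by
    intro x hx
    have h1 := hr x (hUG hx)
    refine Metric.closedBall_subset_ball' ?_
    linarith [h1.1, h1.2.1]
  have hum : Measurable fun x => g x * W x := hg.mul hWm
  have hvm : Measurable fun x => f x * W x := hf.mul hWm
  have hcover : ∫⁻ x in {x | T < g x * W x}, (g x * W x) ^ q ∂(volume.restrict (Metric.ball x0 R))
      ≤ ∑' x : U, ∫⁻ y in Metric.closedBall x.1 (16 * r x), (g y * W y) ^ q := by
    have := hUcount.to_subtype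
    refine le_trans ?_ (lintegral_iUnion_le _ _)
    rw [Measure.restrict_restrict (measurableSet_lt measurable_const hum)]
    refine lintegral_mono' (Measure.restrict_mono_ae ?_) le_rfl
    filter_upwards [hleb] with x hx hxm
    have hxG : x ∈ G := ⟨⟨hxm.2, hxm.1⟩, hx hxm.2 hxm.1⟩
    obtain ⟨y, hy, hsub⟩ := hUc x hxG
    refine mem_iUnion.2 ⟨⟨y, hy⟩, ?_⟩
    have h1 := (hr x hxG).1
    have h2 := (hr y (hUG hy)).1
    have h3 := hsub (Metric.mem_closedBall_self (by linarith))
    exact Metric.closedBall_subset_closedBall (by linarith) h3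
  have hloc : ∀ x : U, ∫⁻ y in Metric.closedBall x.1 (16 * r x), (g y * W y) ^ q ≤
      ENNReal.ofReal K * (T ^ (q - 1) *
        (∫⁻ y in Metric.closedBall x.1 (2 * r x) ∩ {y | T < ENNReal.ofReal H * (g y * W y)}, g y * W y)
        + ∫⁻ y in Metric.closedBall x.1 (2 * r x) ∩ {y | T < ENNReal.ofReal H * (f y * W y)},
          (f y * W y) ^ q) := by
    rintro ⟨x, hxU⟩
    simp only
    obtain ⟨hr0, hr32, hr1, hr2, hr16⟩ := hr x (hUG hxU)
    have hxB := (hUG hxU).1.1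
    have hWx0 := hW0 x hxB
    have h1θ : 0 < 1 - θ := by linarith
    have hv2 := vol_ball n x (2 * r x) (by linarith)
    have hv16 := vol_ball n x (16 * r x) (by linarith)
    have hS0 : volume (Metric.closedBall x (2 * r x)) ≠ 0 := by
      rw [hv2]; exact pow_ne_zero _ (by simpa using hr0)
    have hS : volume (Metric.closedBall x (2 * r x)) ≠ ⊤ := by
      rw [hv2]; exact ENNReal.pow_ne_top ENNReal.ofReal_ne_top
    have hL0 : volume (Metric.closedBall x (16 * r x)) ≠ 0 := by
      rw [hv16]; exact pow_ne_zero _ (by simpa using hr0)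
    have hL : volume (Metric.closedBall x (16 * r x)) ≠ ⊤ := by
      rw [hv16]; exact ENNReal.pow_ne_top ENNReal.ofReal_ne_top
    have hvv : volume (Metric.closedBall x (16 * r x)) = 8 ^ n * volume (Metric.closedBall x (2 * r x)) := by
      rw [hv2, hv16, ← mul_pow]
      congr 1
      have h8 : (8:ℝ≥0∞) = ENNReal.ofReal 8 := by simp
      rw [h8, ← ENNReal.ofReal_mul (by norm_num)]
      congr 1; ring
    refine local_est volume (Metric.closedBall x (2 * r x)) (Metric.closedBall x (16 * r x))
      Metric.isClosed_closedBall.measurableSet Metric.isClosed_closedBall.measurableSet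
      g f W hg hf hWm q hq (W x) (T / W x) T κ (8 ^ n) c1 c2 (ENNReal.ofReal K) (ENNReal.ofReal H)
      hS0 hS hWx0 (hWt x) (fun y _ => hWt y) ?_ ?_ ?_ ?_ ?_ ?_ ?_ ?_ ?_ ?_ ?_ hH1 hH2 hK1 hK2 ?_
    · exact (ENNReal.div_pos hT0 (hWt x)).ne'
    · exact ENNReal.div_ne_top hTt hWx0
    · exact ENNReal.div_mul_cancel hWx0 (hWt x)
    · rw [hκ]; exact ENNReal.rpow_ne_top_of_nonneg hnq (by simp)
    · intro y hy
      apply hWcmp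
      have h1 : dist x y ≤ 16 * r x := by rw [dist_comm]; exact hy
      have h2 := dist_triangle x y x0
      linarith
    · intro y hy
      apply hWcmp
      have h1 : dist y x ≤ 2 * r x := hy
      have h2 := dist_triangle y x x0
      linarith
    · simp only [hA] at hr16
      rw [mul_comm (volume _)⁻¹, ← div_eq_mul_inv, ENNReal.div_le_iff hL0 hL, hvv,
        mul_comm ((T / W x) ^ q)] at hr16
      exact hr16
    · rw [hc1]
      have : 0 < ((1 - θ) / (2 * b)) ^ (1 / q) := Real.rpow_pos_of_pos (by positivity) _
      simpa using this
    · rw [hc1]; exact ENNReal.ofReal_ne_top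
    · rw [hc2]
      have : 0 < (1 - θ) / 2 := by positivity
      simpa using this
    · rw [hc2]; exact ENNReal.ofReal_ne_top
    · rw [hc1, hc2]
      refine dich b θ q hq hb hθ0 hθ1 _ _ _ _ (lt_of_lt_of_le hr1 (hyp x hxB (r x) hr0 ?_)) hr2
      linarith
  refine hcover.trans ((ENNReal.tsum_le_tsum hloc).trans ?_)
  rw [ENNReal.tsum_mul_left, ENNReal.tsum_add, ENNReal.tsum_mul_left]
  gcongr
  · exact sum_le volume U hUcount (fun x => Metric.closedBall x (2 * r x))
      (fun _ => Metric.isClosed_closedBall.measurableSet) hUd (Metric.ball x0 R) _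
      (measurableSet_lt measurable_const (hum.const_mul _)) hballs _
  · exact sum_le volume U hUcount (fun x => Metric.closedBall x (2 * r x))
      (fun _ => Metric.isClosed_closedBall.measurableSet) hUd (Metric.ball x0 R) _
      (measurableSet_lt measurable_const (hvm.const_mul _)) hballs _

lemma gehring_avg (n : ℕ) (q b θ : ℝ) (hq : 1 < q) (hb : 1 < b) (hθ0 : 0 ≤ θ) (hθ1 : θ < 1) :
    ∃ ε C : ℝ, 0 < ε ∧ 1 ≤ C ∧
      ∀ (x0 : Fin n → ℝ) (R : ℝ), 0 < R → ∀ (g f : (Fin n → ℝ) → ℝ≥0∞),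
      Measurable g → Measurable f →
      ∫⁻ x in Metric.closedBall x0 R, g x ^ q < ⊤ →
      (∀ x ∈ Metric.ball x0 R, ∀ r : ℝ, 0 < r → 4 * r ≤ R - dist x x0 →
        (volume (Metric.closedBall x r))⁻¹ * ∫⁻ y in Metric.closedBall x r, g y ^ q
        ≤ ENNReal.ofReal b * ((volume (Metric.closedBall x (2 * r)))⁻¹ *
              ∫⁻ y in Metric.closedBall x (2 * r), g y) ^ q
          + (volume (Metric.closedBall x (2 * r)))⁻¹ * (∫⁻ y in Metric.closedBall x (2 * r), f y ^ q)
          + ENNReal.ofReal θ * ((volume (Metric.closedBall x (2 * r)))⁻¹ *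
              ∫⁻ y in Metric.closedBall x (2 * r), g y ^ q)) →
      ∀ p : ℝ, q ≤ p → p < q + ε →
        (volume (Metric.closedBall x0 (R / 2)))⁻¹ * (∫⁻ x in Metric.closedBall x0 (R / 2), g x ^ p)
        ≤ ENNReal.ofReal C * (((volume (Metric.closedBall x0 R))⁻¹ *
            ∫⁻ x in Metric.closedBall x0 R, g x ^ q) ^ (p / q) +
          (volume (Metric.closedBall x0 R))⁻¹ * ∫⁻ x in Metric.closedBall x0 R, f x ^ p) := by
  have hq0 : 0 < q := by linarith
  have hnq : 0 ≤ (n : ℝ) / q := by positivity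
  have h1θ : 0 < 1 - θ := by linarith
  set c1 : ℝ := ((1 - θ) / (2 * b)) ^ (1 / q) with hc1
  set c2 : ℝ := (1 - θ) / 2 with hc2
  have hc1p : 0 < c1 := Real.rpow_pos_of_pos (by positivity) _
  have hc2p : 0 < c2 := by positivity
  set k : ℝ := 2 ^ ((n : ℝ) / q) with hk
  have hk1 : 1 ≤ k := Real.one_le_rpow (by norm_num) hnq
  have hk0 : 0 < k := by linarith
  have hkq : 0 < k ^ q := Real.rpow_pos_of_pos hk0 _
  set K : ℝ := 8 ^ n * k ^ q * (2 * k) / c1 + 8 ^ n * k ^ q * (2 * k ^ q) / c2 with hK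
  set H : ℝ := 1 + 2 * k / c1 + (2 * k ^ q / c2) ^ (1 / q) with hH
  have hK0 : 0 ≤ K := by positivity
  have hH3 : 0 ≤ (2 * k ^ q / c2) ^ (1 / q) := by positivity
  have hH2 : 0 ≤ 2 * k / c1 := by positivity
  have hH1 : 1 ≤ H := by linarith
  have hH0 : 0 < H := by linarith
  have hHq : 0 < H ^ q := Real.rpow_pos_of_pos hH0 _
  have hκ : ENNReal.ofReal k = 2 ^ ((n : ℝ) / q) := by
    rw [hk, ← ENNReal.ofReal_rpow_of_pos (by norm_num)]; simp
  have cH1 : 2 * ENNReal.ofReal k ≤ ENNReal.ofReal H * ENNReal.ofReal c1 := by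
    have : (2:ℝ≥0∞) = ENNReal.ofReal 2 := by simp
    rw [this, ← ENNReal.ofReal_mul (by norm_num), ← ENNReal.ofReal_mul hH0.le]
    refine ENNReal.ofReal_le_ofReal ?_
    rw [← div_le_iff₀ hc1p]; linarith
  have cH2 : 2 * ENNReal.ofReal k ^ q ≤ ENNReal.ofReal H ^ q * ENNReal.ofReal c2 := by
    have : (2:ℝ≥0∞) = ENNReal.ofReal 2 := by simp
    rw [this, ENNReal.ofReal_rpow_of_pos hk0, ENNReal.ofReal_rpow_of_pos hH0,
      ← ENNReal.ofReal_mul (by norm_num), ← ENNReal.ofReal_mul hHq.le]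
    refine ENNReal.ofReal_le_ofReal ?_
    rw [← div_le_iff₀ hc2p]
    calc 2 * k ^ q / c2 = ((2 * k ^ q / c2) ^ (1 / q)) ^ q := by
          rw [← Real.rpow_mul (show (0:ℝ) ≤ 2 * k ^ q / c2 by positivity),
            one_div_mul_cancel hq0.ne', Real.rpow_one]
      _ ≤ H ^ q := Real.rpow_le_rpow hH3 (by linarith) hq0.le
  have e8 : (8:ℝ≥0∞) ^ n = ENNReal.ofReal (8 ^ n) := by
    rw [ENNReal.ofReal_pow (by norm_num)]; simp
  have cK1 : 8 ^ n * ENNReal.ofReal k ^ q * (2 * ENNReal.ofReal k) ≤ ENNReal.ofReal K * ENNReal.ofReal c1 := by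
    have : (2:ℝ≥0∞) = ENNReal.ofReal 2 := by simp
    rw [e8, this, ENNReal.ofReal_rpow_of_pos hk0, ← ENNReal.ofReal_mul (by positivity),
      ← ENNReal.ofReal_mul (by positivity), ← ENNReal.ofReal_mul (by positivity),
      ← ENNReal.ofReal_mul (by positivity)]
    refine ENNReal.ofReal_le_ofReal ?_
    rw [← div_le_iff₀ hc1p, hK]
    have : 0 ≤ 8 ^ n * k ^ q * (2 * k ^ q) / c2 := by positivity
    linarith
  have cK2 : 8 ^ n * ENNReal.ofReal k ^ q * (2 * ENNReal.ofReal k ^ q) ≤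
      ENNReal.ofReal K * ENNReal.ofReal c2 := by
    have : (2:ℝ≥0∞) = ENNReal.ofReal 2 := by simp
    rw [e8, this, ENNReal.ofReal_rpow_of_pos hk0, ← ENNReal.ofReal_mul (by positivity),
      ← ENNReal.ofReal_mul (by positivity), ← ENNReal.ofReal_mul (by positivity),
      ← ENNReal.ofReal_mul (by positivity)]
    refine ENNReal.ofReal_le_ofReal ?_
    rw [← div_le_iff₀ hc2p, hK]
    have : 0 ≤ 8 ^ n * k ^ q * (2 * k) / c1 := by positivity
    linarith
  set ε : ℝ := min 1 ((q - 1) / (2 * (K + 1) * H ^ q)) with hε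
  set C0 : ℝ := 2 ^ n * (2 * k ^ (q + 1)) * (16 ^ n + K * H) with hC0
  have hkq1 : 1 ≤ k ^ (q + 1) := Real.one_le_rpow hk1 (by linarith)
  have h2n : (1:ℝ) ≤ 2 ^ n := one_le_pow₀ (by norm_num)
  have h16n : (1:ℝ) ≤ 16 ^ n := one_le_pow₀ (by norm_num)
  have hKH : 0 ≤ K * H := by positivity
  have hC2 : (2:ℝ) ^ n ≤ C0 := by
    rw [hC0]
    calc (2:ℝ) ^ n = 2 ^ n * 1 * 1 := by ring
      _ ≤ _ := by
        gcongr <;> linarith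
  refine ⟨ε, C0, ?_, by linarith, ?_⟩
  · rw [hε]; refine lt_min one_pos (div_pos (by linarith) (by positivity))
  intro x0 R hR g f hg hf hI hyp p hqp hpε
  set I := ∫⁻ x in Metric.closedBall x0 R, g x ^ q with hIdef
  set m := volume (Metric.closedBall x0 R) with hm
  have hvR := vol_ball n x0 R hR.le
  have hvR2 := vol_ball n x0 (R / 2) (by linarith)
  rw [← hm] at hvR
  have hm2 : (volume (Metric.closedBall x0 (R / 2)))⁻¹ = 2 ^ n * m⁻¹ := by
    rw [hvR2, hvR, ENNReal.inv_pow, ENNReal.inv_pow, ← mul_pow]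
    congr 1
    rw [← ENNReal.ofReal_inv_of_pos (by positivity), ← ENNReal.ofReal_inv_of_pos (by positivity)]
    have : (2:ℝ≥0∞) = ENNReal.ofReal 2 := by simp
    rw [this, ← ENNReal.ofReal_mul (by norm_num)]
    congr 1; field_simp
  have e2n : (2:ℝ≥0∞) ^ n = ENNReal.ofReal (2 ^ n) := by
    rw [ENNReal.ofReal_pow (by norm_num)]; simp
  have hsubR : Metric.closedBall x0 (R / 2) ⊆ Metric.closedBall x0 R :=
    Metric.closedBall_subset_closedBall (by linarith)
  rw [hm2]
  rcases hqp.eq_or_lt with rfl | hqp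
  · rw [div_self hq0.ne', ENNReal.rpow_one]
    calc 2 ^ n * m⁻¹ * ∫⁻ x in Metric.closedBall x0 (R / 2), g x ^ q ≤ 2 ^ n * m⁻¹ * I := by
          gcongr
          exact lintegral_mono_set hsubR
      _ = ENNReal.ofReal (2 ^ n) * (m⁻¹ * I) := by rw [e2n]; ring
      _ ≤ _ := by
        gcongr
        exact le_self_add
  have hp1 : p < q + 1 := lt_of_lt_of_le hpε (by rw [hε]; gcongr; exact min_le_left _ _)
  have hp0 : 0 < p := by linarith
  have hsmall : (p - q) * K * H ^ (p - 1) / (p - 1) ≤ 1 / 2 := by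
    have h1 : p - q ≤ (q - 1) / (2 * (K + 1) * H ^ q) := by
      have : ε ≤ _ := min_le_right _ _
      linarith
    rw [le_div_iff₀ (by positivity)] at h1
    have h2 : H ^ (p - 1) ≤ H ^ q := Real.rpow_le_rpow_of_exponent_le hH1 (by linarith)
    rw [div_le_iff₀ (by linarith)]
    have h3 : (p - q) * K * H ^ (p - 1) ≤ (p - q) * (K + 1) * H ^ q := by
      have : 0 ≤ p - q := by linarith
      gcongr
      linarith
    linarith
  set W : (Fin n → ℝ) → ℝ≥0∞ := fun y => ENNReal.ofReal ((R - dist y x0) / R) ^ ((n : ℝ) / q) with hW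
  have hWm : Measurable W := by rw [hW]; fun_prop
  have hW1 : ∀ y, W y ≤ 1 := by
    intro y
    refine ENNReal.rpow_le_one ?_ hnq
    rw [ENNReal.ofReal_le_one, div_le_one hR]
    linarith [dist_nonneg (x := y) (y := x0)]
  have hWlow : ∀ y ∈ Metric.closedBall x0 (R / 2), 1 ≤ ENNReal.ofReal k * W y := by
    intro y hy
    have hy' : dist y x0 ≤ R / 2 := hy
    rw [hκ, hW]
    simp only
    rw [← ENNReal.mul_rpow_of_nonneg _ _ hnq]
    have h1 : (1:ℝ≥0∞) ≤ 2 * ENNReal.ofReal ((R - dist y x0) / R) := by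
      have : (2:ℝ≥0∞) = ENNReal.ofReal 2 := by simp
      rw [this, ← ENNReal.ofReal_mul (by norm_num), ENNReal.one_le_ofReal, ← mul_div_assoc,
        le_div_iff₀ hR]
      linarith
    calc (1:ℝ≥0∞) = 1 ^ ((n : ℝ) / q) := (ENNReal.one_rpow _).symm
      _ ≤ _ := ENNReal.rpow_le_rpow h1 hnq
  set J := ENNReal.ofReal (8 / R) ^ n * I with hJ
  have hJt : J ≠ ⊤ := ENNReal.mul_ne_top (ENNReal.pow_ne_top ENNReal.ofReal_ne_top) hI.ne
  have hJ16 : J = 16 ^ n * (m⁻¹ * I) := by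
    rw [hJ, hvR, ENNReal.inv_pow, ← mul_assoc, ← mul_pow]
    congr 2
    have : (16:ℝ≥0∞) = ENNReal.ofReal 16 := by simp
    rw [this, ← ENNReal.ofReal_inv_of_pos (by positivity), ← ENNReal.ofReal_mul (by norm_num)]
    congr 1; field_simp; norm_num
  have hl0 : ENNReal.ofReal (J ^ (1 / q)).toReal = J ^ (1 / q) :=
    ENNReal.ofReal_toReal (ENNReal.rpow_ne_top_of_nonneg (by positivity) hJt)
  have hum : Measurable fun x => g x * W x := hg.mul hWm
  have hvm : Measurable fun x => f x * W x := hf.mul hWm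
  have hug : ∀ x, g x * W x ≤ g x := fun x => mul_le_of_le_one_right zero_le (hW1 x)
  have hvf : ∀ x, f x * W x ≤ f x := fun x => mul_le_of_le_one_right zero_le (hW1 x)
  have hbs : Metric.ball x0 R ⊆ Metric.closedBall x0 R := Metric.ball_subset_closedBall
  have huI : ∫⁻ x in Metric.ball x0 R, (g x * W x) ^ q ≤ I := by
    refine (lintegral_mono fun x => ENNReal.rpow_le_rpow (hug x) hq0.le).trans ?_
    exact lintegral_mono_set hbs
  have hvF : ∫⁻ x in Metric.ball x0 R, (f x * W x) ^ p ≤ ∫⁻ x in Metric.closedBall x0 R, f x ^ p := by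
    refine (lintegral_mono fun x => ENNReal.rpow_le_rpow (hvf x) hp0.le).trans ?_
    exact lintegral_mono_set hbs
  have S := selfimp (volume.restrict (Metric.ball x0 R)) (fun x => g x * W x) (fun x => f x * W x)
    hum hvm q p K H (J ^ (1 / q)).toReal hq hqp hK0 hH1 (lt_of_le_of_lt huI hI) (by
      intro t ht hlt
      rw [← ENNReal.ofReal_rpow_of_pos ht]
      refine level_est n q b θ K H hq hb hθ0 hθ1 _ _ _ rfl rfl hκ cH1 cH2 cK1 cK2 x0 R hR g f hg hf hI
        hyp W rfl t ht ?_
      rw [← hIdef, ← hJ]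
      calc J = (J ^ (1 / q)) ^ q := by
            rw [← ENNReal.rpow_mul, one_div_mul_cancel hq0.ne', ENNReal.rpow_one]
        _ = ENNReal.ofReal (J ^ (1 / q)).toReal ^ q := by rw [hl0]
        _ ≤ _ := by gcongr) hsmall
  rw [hl0] at S
  set a := m⁻¹ * I with ha
  set Fp := ∫⁻ x in Metric.closedBall x0 R, f x ^ p with hFp
  have hGp : ∫⁻ x in Metric.closedBall x0 (R / 2), g x ^ p ≤
      ENNReal.ofReal k ^ p * ∫⁻ x in Metric.ball x0 R, (g x * W x) ^ p := by
    rw [← lintegral_const_mul _ (hum.pow_const p)]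
    calc _ ≤ ∫⁻ x in Metric.closedBall x0 (R / 2), ENNReal.ofReal k ^ p * (g x * W x) ^ p := by
          refine setLIntegral_mono' Metric.isClosed_closedBall.measurableSet fun x hx => ?_
          rw [← ENNReal.mul_rpow_of_nonneg _ _ hp0.le]
          refine ENNReal.rpow_le_rpow ?_ hp0.le
          calc g x = 1 * g x := by ring
            _ ≤ (ENNReal.ofReal k * W x) * g x := by gcongr; exact hWlow x hx
            _ = _ := by ring
      _ ≤ _ := lintegral_mono_set (Metric.closedBall_subset_ball (by linarith))
  have hJp : (J ^ (1 / q)) ^ (p - q) * a ≤ 16 ^ n * a ^ (p / q) := by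
    have hpq : 0 ≤ (p - q) / q := div_nonneg (by linarith) hq0.le
    have e : a ^ (p / q) = a ^ ((p - q) / q) * a := by
      nth_rewrite 3 [← ENNReal.rpow_one a]
      rw [← ENNReal.rpow_add_of_nonneg _ _ hpq zero_le_one]
      congr 1; field_simp; ring
    rw [e, ← ENNReal.rpow_mul, one_div_mul_eq_div, hJ16, ENNReal.mul_rpow_of_nonneg _ _ hpq, mul_assoc]
    gcongr
    have h1 : (1:ℝ≥0∞) ≤ 16 ^ n := one_le_pow₀ (by norm_num)
    calc ((16:ℝ≥0∞) ^ n) ^ ((p - q) / q) ≤ (16 ^ n) ^ (1:ℝ) := by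
          refine ENNReal.rpow_le_rpow_of_exponent_le h1 ?_
          rw [div_le_one hq0]; linarith
      _ = _ := by rw [ENNReal.rpow_one]
  have hkp : ENNReal.ofReal k ^ p ≤ ENNReal.ofReal (k ^ (q + 1)) := by
    rw [ENNReal.ofReal_rpow_of_pos hk0]
    exact ENNReal.ofReal_le_ofReal (Real.rpow_le_rpow_of_exponent_le hk1 hp1.le)
  have hHp : ENNReal.ofReal H ^ (p - q) ≤ ENNReal.ofReal H := by
    rw [ENNReal.ofReal_rpow_of_pos hH0]
    refine ENNReal.ofReal_le_ofReal ?_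
    calc H ^ (p - q) ≤ H ^ (1:ℝ) := Real.rpow_le_rpow_of_exponent_le hH1 (by linarith)
      _ = H := Real.rpow_one H
  have e16 : (16:ℝ≥0∞) ^ n = ENNReal.ofReal (16 ^ n) := by
    rw [ENNReal.ofReal_pow (by norm_num)]; simp
  have e2 : (2:ℝ≥0∞) = ENNReal.ofReal 2 := by simp
  have eC : ENNReal.ofReal C0 = ENNReal.ofReal (2 ^ n) * (ENNReal.ofReal 2 *
      ENNReal.ofReal (k ^ (q + 1))) * (ENNReal.ofReal (16 ^ n) +
        ENNReal.ofReal K * ENNReal.ofReal H) := by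
    rw [hC0, ← ENNReal.ofReal_mul hK0, ← ENNReal.ofReal_add (by positivity) hKH,
      ← ENNReal.ofReal_mul (by norm_num), ← ENNReal.ofReal_mul (by positivity),
      ← ENNReal.ofReal_mul (by positivity)]
  calc 2 ^ n * m⁻¹ * ∫⁻ x in Metric.closedBall x0 (R / 2), g x ^ p
      ≤ 2 ^ n * m⁻¹ * (ENNReal.ofReal k ^ p * (2 * ((J ^ (1 / q)) ^ (p - q) * I +
        ENNReal.ofReal K * ENNReal.ofReal H ^ (p - q) * Fp))) := by
        gcongr 2 ^ n * m⁻¹ * ?_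
        refine hGp.trans ?_
        gcongr
        refine S.trans ?_
        gcongr
    _ = 2 ^ n * (2 * ENNReal.ofReal k ^ p) * ((J ^ (1 / q)) ^ (p - q) * a +
        ENNReal.ofReal K * ENNReal.ofReal H ^ (p - q) * (m⁻¹ * Fp)) := by rw [ha]; ring
    _ ≤ 2 ^ n * (2 * ENNReal.ofReal (k ^ (q + 1))) * (16 ^ n * a ^ (p / q) +
        ENNReal.ofReal K * ENNReal.ofReal H * (m⁻¹ * Fp)) := by gcongr
    _ ≤ 2 ^ n * (2 * ENNReal.ofReal (k ^ (q + 1))) * ((16 ^ n + ENNReal.ofReal K * ENNReal.ofReal H) *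
          (a ^ (p / q) + m⁻¹ * Fp)) := by
        gcongr
        rw [mul_add]
        gcongr
        · exact le_self_add
        · exact le_add_self
    _ = _ := by
        rw [eC, ← e2n, ← e16, ← e2]
        ring

end Helpers

lemma cube_preimage {n : ℕ} (c : EuclideanSpace ℝ (Fin n)) (l : ℝ) (hl : 0 ≤ l) :
    (WithLp.toLp 2) ⁻¹' (cube c l) = Metric.closedBall (WithLp.ofLp c) (l / 2) := by
  ext x
  simp only [cube, Set.mem_preimage, Set.mem_ofPred_eq, Metric.mem_closedBall]
  rw [dist_pi_le_iff (by linarith)]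
  simp [Real.dist_eq]

lemma cube_meas {n : ℕ} (c : EuclideanSpace ℝ (Fin n)) (l : ℝ) : MeasurableSet (cube c l) := by
  have : cube c l = ⋂ i, {x | |x i - c i| ≤ l / 2} := by
    ext x; simp [cube]
  rw [this]
  refine MeasurableSet.iInter fun i => measurableSet_le ?_ measurable_const
  fun_prop

lemma cube_vol {n : ℕ} (c : EuclideanSpace ℝ (Fin n)) (l : ℝ) (hl : 0 ≤ l) :
    volume (cube c l) = volume (Metric.closedBall (WithLp.ofLp c) (l / 2)) := by
  rw [← cube_preimage c l hl]
  exact ((PiLp.volume_preserving_toLp (Fin n)).measure_preimage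
    (cube_meas c l).nullMeasurableSet).symm

lemma cube_int {n : ℕ} (c : EuclideanSpace ℝ (Fin n)) (l : ℝ) (hl : 0 ≤ l)
    (h : EuclideanSpace ℝ (Fin n) → ℝ≥0∞) :
    ∫⁻ x in cube c l, h x ∂volume =
      ∫⁻ x in Metric.closedBall (WithLp.ofLp c) (l / 2), h (WithLp.toLp 2 x) ∂volume := by
  rw [← cube_preimage c l hl]
  exact ((PiLp.volume_preserving_toLp (Fin n)).setLIntegral_comp_preimage_emb
    (MeasurableEquiv.toLp 2 (Fin n → ℝ)).measurableEmbedding h (cube c l)).symm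

/-- Gehring's lemma (Giaquinta, Ch. V, Prop. 1.1): a reverse Hölder inequality on all
small cubes self-improves to higher integrability, with constants depending only on
`b, θ, q, n, s`. -/
theorem gehring_lemma (n : ℕ) (q s b θ : ℝ) (hq : 1 < q) (hs : q < s) (hb : 1 < b)
    (hθ0 : 0 ≤ θ) (hθ1 : θ < 1) :
    ∃ ε C : ℝ, 0 < ε ∧ 0 < C ∧
      ∀ (c0 : EuclideanSpace ℝ (Fin n)) (l0 : ℝ), 0 < l0 →
      ∀ (g f : EuclideanSpace ℝ (Fin n) → ℝ≥0∞), Measurable g → Measurable f →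
        (∫⁻ x in cube c0 l0, g x ^ q ∂volume) < ⊤ →
        (∫⁻ x in cube c0 l0, f x ^ s ∂volume) < ⊤ →
      ∀ R0 : ℝ, 0 < R0 →
        (∀ x0 ∈ cube c0 l0, ∀ R : ℝ, 0 < R → R < R0 →
          cube x0 (4 * R) ⊆ cube c0 l0 →
          (volume (cube x0 R))⁻¹ * ∫⁻ x in cube x0 R, g x ^ q ∂volume
            ≤ ENNReal.ofReal b *
                ((volume (cube x0 (2 * R)))⁻¹ * ∫⁻ x in cube x0 (2 * R), g x ∂volume) ^ q
              + (volume (cube x0 (2 * R)))⁻¹ * ∫⁻ x in cube x0 (2 * R), f x ^ q ∂volume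
              + ENNReal.ofReal θ *
                ((volume (cube x0 (2 * R)))⁻¹ * ∫⁻ x in cube x0 (2 * R), g x ^ q ∂volume)) →
      ∀ p : ℝ, q ≤ p → p < q + ε →
      ∀ (x0 : EuclideanSpace ℝ (Fin n)) (R : ℝ), 0 < R → R < R0 →
        cube x0 (2 * R) ⊆ cube c0 l0 →
        (∫⁻ x in cube x0 R, g x ^ p ∂volume) < ⊤ ∧
        ((volume (cube x0 R))⁻¹ * ∫⁻ x in cube x0 R, g x ^ p ∂volume) ^ (1 / p)
          ≤ ENNReal.ofReal C *
            (((volume (cube x0 (2 * R)))⁻¹ *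
                ∫⁻ x in cube x0 (2 * R), g x ^ q ∂volume) ^ (1 / q)
              + ((volume (cube x0 (2 * R)))⁻¹ *
                  ∫⁻ x in cube x0 (2 * R), f x ^ p ∂volume) ^ (1 / p)) := by
  obtain ⟨ε, C, hε, hC, main⟩ := gehring_avg n q b θ hq hb hθ0 hθ1
  refine ⟨min ε (s - q), C, lt_min hε (by linarith), by linarith, ?_⟩
  intro c0 l0 hl0 g f hg hf hgI hfI R0 hR0 hyp p hqp hp x0 R hR hRR0 hsub
  have hpε : p < q + ε := lt_of_lt_of_le hp (by gcongr; exact min_le_left _ _)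
  have hps : p < s := by
    have := min_le_right ε (s - q)
    linarith
  have hq0 : 0 < q := by linarith
  have hp0 : 0 < p := by linarith
  have htm : Measurable (WithLp.toLp 2 : (Fin n → ℝ) → EuclideanSpace ℝ (Fin n)) :=
    (PiLp.volume_preserving_toLp (Fin n)).measurable
  have e2R : 2 * R / 2 = R := by ring
  have hgI2 : ∫⁻ x in cube x0 (2 * R), g x ^ q ∂volume < ⊤ :=
    lt_of_le_of_lt (lintegral_mono_set hsub) hgI
  have hV := cube_vol x0 (2 * R) (by linarith)
  rw [e2R] at hV
  have hvR := vol_ball n (WithLp.ofLp x0) R hR.le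
  have hvR2 := vol_ball n (WithLp.ofLp x0) (R / 2) (by linarith)
  have A := main (WithLp.ofLp x0) R hR (fun x => g (WithLp.toLp 2 x)) (fun x => f (WithLp.toLp 2 x))
    (hg.comp htm) (hf.comp htm) (by
      have := cube_int x0 (2 * R) (by linarith) (fun x => g x ^ q)
      rw [e2R] at this
      rw [← this]
      exact hgI2) (by
      intro x hx r hr h4
      have hd : dist x (WithLp.ofLp x0) < R := hx
      have hd0 : 0 ≤ dist x (WithLp.ofLp x0) := dist_nonneg
      have hsub2 : cube (WithLp.toLp 2 x) (4 * (2 * r)) ⊆ cube x0 (2 * R) := by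
        intro y hy i
        have h1 := hy i
        have h2 : |x i - x0 i| ≤ dist x (WithLp.ofLp x0) := by
          have := dist_le_pi_dist x (WithLp.ofLp x0) i
          rwa [Real.dist_eq] at this
        have h3 : |y i - x0 i| ≤ |y i - x i| + |x i - x0 i| := abs_sub_le _ _ _
        have h1' : |y i - x i| ≤ 4 * (2 * r) / 2 := h1
        linarith
      have hmem : WithLp.toLp 2 x ∈ cube x0 (2 * R) := by
        refine hsub2 ?_
        intro i
        simp
        linarith
      have B := hyp (WithLp.toLp 2 x) (hsub hmem) (2 * r) (by linarith) (by linarith)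
        (hsub2.trans hsub)
      have e1 : 2 * r / 2 = r := by ring
      have e2 : 2 * (2 * r) / 2 = 2 * r := by ring
      rw [cube_vol _ (2 * r) (by linarith), cube_vol _ (2 * (2 * r)) (by linarith),
        cube_int _ (2 * r) (by linarith), cube_int _ (2 * (2 * r)) (by linarith),
        cube_int _ (2 * (2 * r)) (by linarith), cube_int _ (2 * (2 * r)) (by linarith), e1, e2] at B
      exact B) p hqp hpε
  have i1 := cube_int x0 R hR.le (fun x => g x ^ p)
  have i2 := cube_int x0 (2 * R) (by linarith) (fun x => g x ^ q)
  have i3 := cube_int x0 (2 * R) (by linarith) (fun x => f x ^ p)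
  rw [e2R] at i2 i3
  rw [← hV] at A
  rw [← cube_vol x0 R hR.le] at A
  beta_reduce at A
  rw [← i1, ← i2, ← i3] at A
  rw [← hV] at hvR
  rw [← cube_vol x0 R hR.le] at hvR2
  set V := volume (cube x0 (2 * R)) with hVd
  set v := volume (cube x0 R) with hvd
  set G := ∫⁻ x in cube x0 R, g x ^ p ∂volume with hGd
  set I := ∫⁻ x in cube x0 (2 * R), g x ^ q ∂volume with hId
  set F := ∫⁻ x in cube x0 (2 * R), f x ^ p ∂volume with hFd
  have hVt : V ≠ ⊤ := by rw [hvR]; exact ENNReal.pow_ne_top ENNReal.ofReal_ne_top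
  have hvt : v ≠ ⊤ := by rw [hvR2]; exact ENNReal.pow_ne_top ENNReal.ofReal_ne_top
  have hV0 : V ≠ 0 := by
    rw [hvR]; refine pow_ne_zero _ ?_
    simp [hR]
  have hF : F < ⊤ := by
    calc F ≤ ∫⁻ x in cube x0 (2 * R), (1 + f x ^ s) ∂volume := by
          refine lintegral_mono fun x => ?_
          rcases le_total (f x) 1 with h | h
          · exact (ENNReal.rpow_le_one h hp0.le).trans le_self_add
          · exact (ENNReal.rpow_le_rpow_of_exponent_le h hps.le).trans le_add_self
      _ = V + ∫⁻ x in cube x0 (2 * R), f x ^ s ∂volume := by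
          rw [lintegral_add_left measurable_const]; simp [hVd]
      _ < ⊤ := ENNReal.add_lt_top.2 ⟨hVt.lt_top,
          lt_of_le_of_lt (lintegral_mono_set hsub) hfI⟩
  have hVi : V⁻¹ ≠ ⊤ := ENNReal.inv_ne_top.2 hV0
  have hfin : v⁻¹ * G < ⊤ := by
    refine lt_of_le_of_lt A ?_
    refine ENNReal.mul_lt_top ENNReal.ofReal_lt_top (ENNReal.add_lt_top.2 ⟨?_, ?_⟩)
    · exact ENNReal.rpow_lt_top_of_nonneg (by positivity) (ENNReal.mul_ne_top hVi hgI2.ne)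
    · exact ENNReal.mul_lt_top hVi.lt_top hF
  refine ⟨?_, ?_⟩
  · by_contra hG
    rw [not_lt_top_iff] at hG
    rw [hG, ENNReal.mul_top (ENNReal.inv_ne_zero.2 hvt)] at hfin
    exact absurd hfin (lt_irrefl _)
  · have hp1 : 0 ≤ 1 / p := by positivity
    have hp1' : 1 / p ≤ 1 := by rw [div_le_one hp0]; linarith
    calc (v⁻¹ * G) ^ (1 / p) ≤ (ENNReal.ofReal C * ((V⁻¹ * I) ^ (p / q) + V⁻¹ * F)) ^ (1 / p) :=
          ENNReal.rpow_le_rpow A hp1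
      _ = ENNReal.ofReal C ^ (1 / p) * ((V⁻¹ * I) ^ (p / q) + V⁻¹ * F) ^ (1 / p) :=
          ENNReal.mul_rpow_of_nonneg _ _ hp1
      _ ≤ ENNReal.ofReal C ^ (1 : ℝ) *
            (((V⁻¹ * I) ^ (p / q)) ^ (1 / p) + (V⁻¹ * F) ^ (1 / p)) := by
          refine mul_le_mul' (ENNReal.rpow_le_rpow_of_exponent_le ?_ hp1')
            (ENNReal.rpow_add_le_add_rpow _ _ hp1 hp1')
          exact ENNReal.one_le_ofReal.2 hC
      _ = _ := by
          have epq : p / q * (1 / p) = 1 / q := by field_simp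
          rw [ENNReal.rpow_one, ← ENNReal.rpow_mul, epq]
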